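/- arXiv:1609.08077 — 2 statements merged into one kernel-verified Lean document; each statement's English description precedes it below -/
import Mathlib

section
/- The assignments (A, d_m) ↦ (Tot(A), d, F), where F is the column filtration and d is the totalized differential, and f ↦ Tot(f), define a functor Tot from the category of twisted complexes over R to the category of filtered cochain complexes over R: d∘d = 0, d(F_p Tot(A)) ⊆ F_p Tot(A), Tot(f) is a filtration-preserving chain map, Tot of the identity is the identity, and Tot(f∘g) = Tot(f)∘Tot(g). Moreover, every value of Tot is a split filtered complex, and Tot restricts to an isomorphism of categories onto the full subcategory of split filtered complexes: it is bijective on objects onto split filtered complexes, and for all twisted complexes A, B the map f ↦ Tot(f) is a bijection from morphisms of twisted complexes A → B to filtration-preserving chain maps Tot(A) → Tot(B). -/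
open Finset

noncomputable section

/-- A `(ℤ,ℤ)`-bigraded `R`-module. -/
structure Bigraded (R : Type) [CommRing R] where
  M : ℤ → ℤ → Type
  [acg : ∀ i j, AddCommGroup (M i j)]
  [mod : ∀ i j, Module R (M i j)]

attribute [instance] Bigraded.acg Bigraded.mod

variable {R : Type} [CommRing R]

/-- Transport along equalities of bidegrees. -/
def Bigraded.cast (A : Bigraded R) {i i' j j' : ℤ} (hi : i = i') (hj : j = j') :
    A.M i j →ₗ[R] A.M i' j' := by subst hi; subst hj; exact LinearMap.id

/-- Maps of bigraded modules of bidegree `(p,q)`. -/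
abbrev GMap (A B : Bigraded R) (p q : ℤ) : Type :=
  ∀ i j : ℤ, A.M i j →ₗ[R] B.M (i + p) (j + q)

/-- Change the recorded bidegree of a graded map along equalities of bidegrees. -/
def grecast {A B : Bigraded R} {p q : ℤ} (p' q' : ℤ) (hp : p = p') (hq : q = q')
    (f : GMap A B p q) : GMap A B p' q' :=
  fun i j => (B.cast (by rw [hp]) (by rw [hq])).comp (f i j)

/-- Composition of graded maps: apply `f` first, then `g`. -/
def gcomp {A B C : Bigraded R} {p q p' q' : ℤ} (g : GMap B C p' q') (f : GMap A B p q) :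
    GMap A C (p + p') (q + q') :=
  fun i j => (C.cast (by ring) (by ring)).comp ((g (i + p) (j + q)).comp (f i j))

/-- The identity as a graded map of bidegree `(0,0)`. -/
def idG (A : Bigraded R) : GMap A A 0 0 := fun i j => A.cast (by ring) (by ring)

/-- An element of `wbimod(A,B)_u^v`, i.e. a family of bigraded maps `f_m : A → B` of
bidegree `(u-m, v-m)` for `m ≥ 0`. -/
abbrev WMap (A B : Bigraded R) (u v : ℤ) : Type :=
  ∀ m : ℕ, GMap A B (u - (m : ℤ)) (v - (m : ℤ))

/-- The family of maps `(d_m)` makes `A` into a twisted complex: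
`∑_{i+j=m} (-1)^i d_i d_j = 0` for all `m ≥ 0`. -/
def IsTwDiff (A : Bigraded R) (d : WMap A A 0 1) : Prop :=
  ∀ m : ℕ, ∑ ij ∈ (antidiagonal m).attach,
      ((-1 : ℤ) ^ ij.1.1) •
        grecast (0 - (m : ℤ)) (2 - (m : ℤ))
          (by have := mem_antidiagonal.mp ij.2; omega)
          (by have := mem_antidiagonal.mp ij.2; omega)
          (gcomp (d ij.1.1) (d ij.1.2)) = 0

/-- The family `(f_m)` is a morphism of twisted complexes from `(A, dA)` to `(B, dB)`:
`∑_{i+j=m} d_i^B f_j = ∑_{i+j=m} (-1)^i f_i d_j^A` for all `m ≥ 0`. -/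
def IsTwMor {A B : Bigraded R} (dA : WMap A A 0 1) (dB : WMap B B 0 1)
    (f : WMap A B 0 0) : Prop :=
  ∀ m : ℕ,
    (∑ ij ∈ (antidiagonal m).attach,
      grecast (0 - (m : ℤ)) (1 - (m : ℤ))
        (by have := mem_antidiagonal.mp ij.2; omega)
        (by have := mem_antidiagonal.mp ij.2; omega)
        (gcomp (dB ij.1.1) (f ij.1.2)))
    = ∑ ij ∈ (antidiagonal m).attach,
      ((-1 : ℤ) ^ ij.1.1) •
        grecast (0 - (m : ℤ)) (1 - (m : ℤ))
          (by have := mem_antidiagonal.mp ij.2; omega)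
          (by have := mem_antidiagonal.mp ij.2; omega)
          (gcomp (f ij.1.1) (dA ij.1.2))

/-- A twisted complex (multicomplex) over `R`. -/
structure TwComplex (R : Type) [CommRing R] extends Bigraded R where
  d : WMap toBigraded toBigraded 0 1
  isTw : IsTwDiff toBigraded d

/-- A morphism of twisted complexes. -/
structure TwMorphism (A B : TwComplex R) where
  f : WMap A.toBigraded B.toBigraded 0 0
  isMor : IsTwMor A.d B.d f

/-- Composition of families: `(g ∘ f)_m = ∑_{i+j=m} g_i f_j`. -/
def compFam {A B C : Bigraded R} (g : WMap B C 0 0) (f : WMap A B 0 0) : WMap A C 0 0 :=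
  fun m => ∑ ij ∈ (antidiagonal m).attach,
    grecast (0 - (m : ℤ)) (0 - (m : ℤ))
      (by have := mem_antidiagonal.mp ij.2; omega)
      (by have := mem_antidiagonal.mp ij.2; omega)
      (gcomp (g ij.1.1) (f ij.1.2))

/-- A strict family: concentrated in stage `0`. -/
def strictW {A B : Bigraded R} (g : GMap A B 0 0) : WMap A B 0 0 :=
  fun m => if h : m = 0 then grecast (0 - (m : ℤ)) (0 - (m : ℤ)) (by omega) (by omega) g else 0

/-- The identity family of maps. -/
def idW (A : Bigraded R) : WMap A A 0 0 := strictW (idG A)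

/-! ## Totalization -/

/-- The underlying graded module of the totalization:
`Tot(A)^n = Π_{i≤0} A_i^{n+i} ⊕ ⊕_{i>0} A_i^{n+i}`, realized as the submodule of
`Π_i A_i^{n+i}` of elements whose components vanish for `i` large. -/
def totCarrier (A : Bigraded R) (n : ℤ) : Submodule R (∀ i : ℤ, A.M i (n + i)) where
  carrier := {a | ∃ N : ℤ, ∀ i : ℤ, N ≤ i → a i = 0}
  add_mem' := by
    rintro a b ⟨N, hN⟩ ⟨N', hN'⟩
    exact ⟨max N N', fun i hi => by
      have h1 := hN i (le_trans (le_max_left _ _) hi)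
      have h2 := hN' i (le_trans (le_max_right _ _) hi)
      simp [h1, h2]⟩
  zero_mem' := ⟨0, fun i _ => rfl⟩
  smul_mem' := by
    rintro c a ⟨N, hN⟩
    exact ⟨N, fun i hi => by simp [hN i hi]⟩

/-- `Tot(A)^n`. -/
abbrev TotM (A : Bigraded R) (n : ℤ) : Type := ↥(totCarrier A n)

/-- The column filtration: `F_p Tot(A)^n = Π_{i ≤ p} A_i^{n+i}`. -/
def totFilt (A : Bigraded R) (p n : ℤ) : Submodule R (TotM A n) where
  carrier := {a | ∀ i : ℤ, p < i → (a : ∀ i : ℤ, A.M i (n + i)) i = 0}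
  add_mem' := by
    intro a b ha hb i hi
    simp [ha i hi, hb i hi]
  zero_mem' := fun i _ => rfl
  smul_mem' := by
    intro c a ha i hi
    simp [ha i hi]

/-- Transport of totalizations along an equality of degrees. -/
def totCastL (A : Bigraded R) {n n' : ℤ} (h : n = n') : TotM A n →ₗ[R] TotM A n' := by
  subst h; exact LinearMap.id

/-- The `m`-th term of the totalization of a `wbimod`-element `F` of bidegree `(u,v)`
applied to `a`, in column `k`: `(-1)^{(m+u)n} F_m(a_{k-u+m})`. -/
def totTerm {A B : Bigraded R} {u v : ℤ} (F : WMap A B u v) (n : ℤ)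
    (a : ∀ i : ℤ, A.M i (n + i)) (k : ℤ) (m : ℕ) : B.M k ((n + v - u) + k) :=
  (Int.negOnePow (((m : ℤ) + u) * n) : ℤ) •
    B.cast (by ring) (by ring) (F m (k - u + m) (n + (k - u + m)) (a (k - u + m)))

theorem totTerm_eq_zero {A B : Bigraded R} {u v : ℤ} (F : WMap A B u v) (n : ℤ)
    (a : ∀ i : ℤ, A.M i (n + i)) (k : ℤ) (m : ℕ) (h : a (k - u + m) = 0) :
    totTerm F n a k m = 0 := by
  simp [totTerm, h]

theorem totTerm_support_finite {A B : Bigraded R} {u v : ℤ} (F : WMap A B u v) (n : ℤ)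
    (a : ∀ i : ℤ, A.M i (n + i)) (ha : a ∈ totCarrier A n) (k : ℤ) :
    (Function.support (totTerm F n a k)).Finite := by
  obtain ⟨N, hN⟩ := ha
  apply Set.Finite.subset (Set.finite_Iio (N - k + u).toNat)
  intro m hm
  rw [Function.mem_support] at hm
  rw [Set.mem_Iio]
  by_contra hc
  push_neg at hc
  exact hm (totTerm_eq_zero _ _ _ _ _ (hN _ (by omega)))

/-- The underlying function of the totalization of `F` applied to `a`. -/
def totFun {A B : Bigraded R} {u v : ℤ} (F : WMap A B u v) (n : ℤ) (a : TotM A n)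
    (k : ℤ) : B.M k ((n + v - u) + k) :=
  ∑ᶠ m : ℕ, totTerm F n a.1 k m

theorem totFun_mem {A B : Bigraded R} {u v : ℤ} (F : WMap A B u v) (n : ℤ) (a : TotM A n) :
    totFun F n a ∈ totCarrier B (n + v - u) := by
  obtain ⟨N, hN⟩ := a.2
  exact ⟨N + u, fun k hk => finsum_eq_zero_of_forall_eq_zero
    fun m => totTerm_eq_zero _ _ _ _ _ (hN _ (by omega))⟩

/-- The totalization of a `wbimod`-element `F` of bidegree `(u,v)`:
`(Tot(F)(a))_{j+u} = ∑_{m≥0} (-1)^{(m+u)n} F_m(a_{j+m})`. -/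
def totGen {A B : Bigraded R} {u v : ℤ} (F : WMap A B u v) (n : ℤ) :
    TotM A n →ₗ[R] TotM B (n + v - u) where
  toFun a := ⟨totFun F n a, totFun_mem F n a⟩
  map_add' a b := by
    apply Subtype.ext
    funext k
    have h1 := totTerm_support_finite F n a.1 a.2 k
    have h2 := totTerm_support_finite F n b.1 b.2 k
    have key : (fun m => totTerm F n (↑(a + b)) k m)
        = fun m => totTerm F n a.1 k m + totTerm F n b.1 k m := by
      funext m
      simp [totTerm, smul_add]
    show (∑ᶠ m, totTerm F n (↑(a + b)) k m) = _
    rw [key, finsum_add_distrib h1 h2]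
    rfl
  map_smul' c a := by
    apply Subtype.ext
    funext k
    have h1 := totTerm_support_finite F n a.1 a.2 k
    have key : (fun m => totTerm F n (↑(c • a)) k m)
        = fun m => c • totTerm F n a.1 k m := by
      funext m
      show totTerm F n (c • a.1) k m = _
      simp only [totTerm, Pi.smul_apply, map_smul]
      rw [smul_comm]
    show (∑ᶠ m, totTerm F n (↑(c • a)) k m) = _
    rw [key]
    rw [finsum_eq_finset_sum_of_support_subset _
      (s := h1.toFinset) (by
        intro m hm
        rw [Function.mem_support] at hm
        simp only [Finset.mem_coe, Set.Finite.mem_toFinset, Function.mem_support]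
        intro h0
        exact hm (by rw [h0, smul_zero])),
      ← Finset.smul_sum, ← finsum_eq_sum _ h1]
    rfl

/-- The totalization of a twisted-complex structure, as the differential on `Tot(A)`. -/
def totDW {A : Bigraded R} (d : WMap A A 0 1) (n : ℤ) : TotM A n →ₗ[R] TotM A (n + 1) :=
  (totCastL A (by ring)).comp (totGen d n)

/-- The totalization of a morphism family `f` of bidegree `(0,0)`. -/
def totMorW {A B : Bigraded R} (f : WMap A B 0 0) (n : ℤ) : TotM A n →ₗ[R] TotM B n :=
  (totCastL B (by ring)).comp (totGen f n)

@[simp]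
theorem Bigraded.cast_rfl (A : Bigraded R) {i j : ℤ} (hi : i = i) (hj : j = j) (x : A.M i j) :
    A.cast hi hj x = x := rfl

@[simp]
theorem Bigraded.cast_cast (A : Bigraded R) {i i' i'' j j' j'' : ℤ} (hi : i = i') (hj : j = j')
    (hi' : i' = i'') (hj' : j' = j'') (x : A.M i j) :
    A.cast hi' hj' (A.cast hi hj x) = A.cast (hi.trans hi') (hj.trans hj') x := by
  subst hi hj hi' hj'
  rfl

/-- The component of a graded map between two prescribed bidegrees. -/
def GMap.entry {A B : Bigraded R} {p q : ℤ} (F : GMap A B p q) {i j i' j' : ℤ}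
    (hi : i + p = i') (hj : j + q = j') : A.M i j →ₗ[R] B.M i' j' :=
  (B.cast hi hj).comp (F i j)

namespace GMap

variable {A B C : Bigraded R} {p q p' q' : ℤ}

theorem entry_grecast (F : GMap A B p q) (hp : p = p') (hq : q = q') {i j i' j' : ℤ}
    (hi : i + p' = i') (hj : j + q' = j') :
    GMap.entry (grecast p' q' hp hq F) hi hj = GMap.entry F (hp ▸ hi) (hq ▸ hj) := by
  subst hp hq hi hj
  rfl

theorem entry_gcomp (G : GMap B C p' q') (F : GMap A B p q) {i j i' j' i'' j'' : ℤ}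
    (hi : i + p = i') (hj : j + q = j') (hi' : i' + p' = i'') (hj' : j' + q' = j'') :
    GMap.entry (gcomp G F) (i := i) (j := j) (i' := i'') (j' := j'')
      (by omega) (by omega) = (GMap.entry G hi' hj').comp (GMap.entry F hi hj) := by
  subst hi hj hi' hj'
  ext x
  simp [GMap.entry, gcomp]

theorem entry_sum {ι : Type*} (s : Finset ι) (F : ι → GMap A B p q) {i j i' j' : ℤ}
    (hi : i + p = i') (hj : j + q = j') :
    GMap.entry (∑ t ∈ s, F t) hi hj = ∑ t ∈ s, GMap.entry (F t) hi hj := by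
  subst hi hj
  ext x
  simp [GMap.entry]

theorem entry_zsmul (c : ℤ) (F : GMap A B p q) {i j i' j' : ℤ}
    (hi : i + p = i') (hj : j + q = j') :
    GMap.entry (c • F) hi hj = c • GMap.entry F hi hj := by
  subst hi hj
  ext x
  simp [GMap.entry]

end GMap

/-- The inclusion of a column into the totalization. -/
def totSingle (A : Bigraded R) (n l : ℤ) : A.M l (n + l) →ₗ[R] TotM A n :=
  (LinearMap.single R (fun i : ℤ => A.M i (n + i)) l).codRestrict (totCarrier A n) fun x =>
    ⟨l + 1, fun i hi => by
      rw [LinearMap.single_apply, Pi.single_eq_of_ne (by omega)]⟩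

@[simp]
theorem totSingle_same (A : Bigraded R) (n l : ℤ) (x : A.M l (n + l)) :
    (totSingle A n l x).1 l = x :=
  Pi.single_eq_same (M := fun i : ℤ => A.M i (n + i)) l x

theorem totSingle_of_ne (A : Bigraded R) (n : ℤ) {l k : ℤ} (h : k ≠ l) (x : A.M l (n + l)) :
    (totSingle A n l x).1 k = 0 :=
  Pi.single_eq_of_ne (M := fun i : ℤ => A.M i (n + i)) h x

theorem totSingle_mem_totFilt (A : Bigraded R) (n l : ℤ) (x : A.M l (n + l)) :
    totSingle A n l x ∈ totFilt A l n :=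
  fun _ hi => totSingle_of_ne A n hi.ne' x

/-- A linear map of totalizations preserves the column filtration. -/
def PreservesFilt {A B : Bigraded R} {n n' : ℤ} (T : TotM A n →ₗ[R] TotM B n') : Prop :=
  ∀ p : ℤ, ∀ a ∈ totFilt A p n, T a ∈ totFilt B p n'

section Filtered

variable {A B : Bigraded R} {n n' : ℤ}

theorem PreservesFilt.apply_eq_sum {T : TotM A n →ₗ[R] TotM B n'} (hT : PreservesFilt T)
    {N : ℤ} {a : TotM A n} (ha : a ∈ totFilt A N n) (k : ℤ) :
    (T a).1 k = ∑ l ∈ Icc k N, (T (totSingle A n l (a.1 l))).1 k := by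
  have hmem : a - ∑ l ∈ Icc k N, totSingle A n l (a.1 l) ∈ totFilt A (k - 1) n := by
    intro i hi
    simp only [Submodule.coe_sub, Submodule.coe_sum, Pi.sub_apply, Finset.sum_apply]
    by_cases hiN : i ≤ N
    · rw [Finset.sum_eq_single_of_mem i (mem_Icc.mpr ⟨by omega, hiN⟩)
        fun l _ hl => totSingle_of_ne A n hl.symm _]
      exact sub_eq_zero.mpr (totSingle_same A n i _).symm
    · rw [ha i (by omega), Finset.sum_eq_zero fun l hl => totSingle_of_ne A n
        (by have := (mem_Icc.mp hl).2; omega) _, sub_zero]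
  have h := hT _ _ hmem k (by omega)
  simp only [map_sub, map_sum, Submodule.coe_sub, Submodule.coe_sum, Pi.sub_apply,
    Finset.sum_apply] at h
  exact sub_eq_zero.mp h

theorem exists_mem_totFilt (a : TotM A n) : ∃ N, a ∈ totFilt A N n := by
  obtain ⟨N, hN⟩ := a.2
  exact ⟨N, fun i hi => hN i hi.le⟩

theorem PreservesFilt.ext {T T' : TotM A n →ₗ[R] TotM B n'} (hT : PreservesFilt T)
    (hT' : PreservesFilt T')
    (h : ∀ (k : ℤ) (m : ℕ) (x : A.M (k + m) (n + (k + m))),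
      (T (totSingle A n (k + m) x)).1 k = (T' (totSingle A n (k + m) x)).1 k) : T = T' := by
  ext a k
  obtain ⟨N, hN⟩ := exists_mem_totFilt a
  rw [hT.apply_eq_sum hN, hT'.apply_eq_sum hN]
  refine Finset.sum_congr rfl fun l hl => ?_
  obtain ⟨m, rfl⟩ := Int.le.dest (mem_Icc.mp hl).1
  exact h k m _

theorem PreservesFilt.comp {C : Bigraded R} {n'' : ℤ} {S : TotM B n' →ₗ[R] TotM C n''}
    {T : TotM A n →ₗ[R] TotM B n'} (hS : PreservesFilt S) (hT : PreservesFilt T) :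
    PreservesFilt (S.comp T) :=
  fun p a ha => hS p _ (hT p a ha)

end Filtered

theorem sum_Icc_eq_sum_antidiagonal {M : Type*} [AddCommMonoid M] (k : ℤ) (m : ℕ) (f : ℤ → M) :
    ∑ c ∈ Icc k (k + m), f c = ∑ p ∈ antidiagonal m, f (k + p.1) := by
  refine Finset.sum_bij' (fun c _ => ((c - k).toNat, (k + m - c).toNat))
    (fun p _ => k + (p.1 : ℤ)) ?_ ?_ ?_ ?_ ?_
  · intro c hc
    have := mem_Icc.mp hc
    exact HasAntidiagonal.mem_antidiagonal.mpr (by omega)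
  · intro p hp
    have := mem_antidiagonal.mp hp
    rw [mem_Icc]
    omega
  · intro c hc
    have := mem_Icc.mp hc
    simp only
    omega
  · intro p hp
    have := mem_antidiagonal.mp hp
    ext <;> simp only <;> omega
  · intro c hc
    have := mem_Icc.mp hc
    simp only
    congr 1
    omega

/-- The totalization of a family of bidegree `(0, v)`, with target in a prescribed degree. -/
def totW {A B : Bigraded R} {v : ℤ} (F : WMap A B 0 v) (n n' : ℤ) (h : n + v = n') :
    TotM A n →ₗ[R] TotM B n' :=
  (totCastL B (by omega)).comp (totGen F n)

section Totalization

variable {A B C : Bigraded R} {v v' w : ℤ}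

theorem totW_apply (F : WMap A B 0 v) {n n' : ℤ} (h : n + v = n') (a : TotM A n) (k : ℤ) :
    (totW F n n' h a).1 k = ∑ᶠ m : ℕ, (Int.negOnePow ((m : ℤ) * n) : ℤ) •
      GMap.entry (F m) (i' := k) (j' := n' + k) (by omega) (by omega) (a.1 (k + m)) := by
  obtain rfl : n + v - 0 = n' := by omega
  refine finsum_congr fun m => ?_
  have key : ∀ (l : ℤ) (hl : k - 0 + m = l), totTerm F n a.1 k m =
      (Int.negOnePow ((m : ℤ) * n) : ℤ) •
        GMap.entry (F m) (i' := k) (j' := n + v - 0 + k) (by omega) (by omega) (a.1 l) := by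
    rintro l rfl
    simp only [totTerm, add_zero]
    rfl
  exact key _ (by omega)

theorem totW_preservesFilt (F : WMap A B 0 v) {n n' : ℤ} (h : n + v = n') :
    PreservesFilt (totW F n n' h) := by
  intro p a ha k hk
  rw [totW_apply]
  refine finsum_eq_zero_of_forall_eq_zero fun m => ?_
  rw [ha _ (by omega), map_zero, smul_zero]

theorem totW_single (F : WMap A B 0 v) {n n' k l : ℤ} (h : n + v = n') (m : ℕ)
    (hl : k + m = l) (x : A.M l (n + l)) :
    (totW F n n' h (totSingle A n l x)).1 k = (Int.negOnePow ((m : ℤ) * n) : ℤ) •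
      GMap.entry (F m) (i' := k) (j' := n' + k) (by omega) (by omega) x := by
  subst hl
  rw [totW_apply, finsum_eq_single _ m, totSingle_same]
  intro m' hm'
  rw [totSingle_of_ne A n (by omega), map_zero, smul_zero]

/-- The signed convolution product `(G * F)_m = ∑_{i+j=m} (-1)^{iv} G_i F_j`, where `v` is the
total degree of `F`. -/
def prodW (G : WMap B C 0 v') (F : WMap A B 0 v) (hw : v + v' = w) : WMap A C 0 w :=
  fun m => ∑ ij ∈ (antidiagonal m).attach,
    (Int.negOnePow ((ij.1.1 : ℤ) * v) : ℤ) • grecast (0 - (m : ℤ)) (w - (m : ℤ))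
      (by have := mem_antidiagonal.mp ij.2; omega)
      (by have := mem_antidiagonal.mp ij.2; omega)
      (gcomp (G ij.1.1) (F ij.1.2))

theorem totW_comp (G : WMap B C 0 v') (F : WMap A B 0 v) (hw : v + v' = w) {n n' n'' : ℤ}
    (h : n + v = n') (h' : n' + v' = n'') :
    (totW G n' n'' h').comp (totW F n n' h) = totW (prodW G F hw) n n'' (by omega) := by
  refine ((totW_preservesFilt G h').comp (totW_preservesFilt F h)).ext
    (totW_preservesFilt _ _) fun k m x => ?_
  rw [totW_single _ _ m rfl, LinearMap.comp_apply, (totW_preservesFilt G h').apply_eq_sum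
    (totW_preservesFilt F h _ _ (totSingle_mem_totFilt A n _ x)), sum_Icc_eq_sum_antidiagonal,
    ← Finset.sum_attach, prodW, GMap.entry_sum, LinearMap.sum_apply, Finset.smul_sum]
  refine Finset.sum_congr rfl fun ij _ => ?_
  have hij := mem_antidiagonal.mp ij.2
  rw [totW_single G h' ij.1.1 rfl, totW_single F h ij.1.2 (by omega), GMap.entry_zsmul,
    GMap.entry_grecast, GMap.entry_gcomp (i' := k + ij.1.1) (j' := n' + (k + ij.1.1)) _ _
      (by omega) (by omega) (by omega) (by omega),
    map_zsmul, LinearMap.smul_apply, LinearMap.comp_apply, smul_smul, smul_smul,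
    ← Units.val_mul, ← Units.val_mul, ← Int.negOnePow_add, ← Int.negOnePow_add]
  congr 3
  subst h
  have hm : (m : ℤ) = ij.1.1 + ij.1.2 := by omega
  linear_combination -n * hm

theorem totW_injective {F G : WMap A B 0 v} (t : ℤ → ℤ) (ht : ∀ n, n + v = t n)
    (h : ∀ n, totW F n (t n) (ht n) = totW G n (t n) (ht n)) : F = G := by
  funext m i j
  obtain ⟨n, rfl⟩ : ∃ n, j = n + i := ⟨j - i, by omega⟩
  ext x
  have key := congrArg (fun T => (T (totSingle A n i x)).1 (i + (0 - (m : ℤ)))) (h n)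
  simp only [totW_single _ (ht n) m (show i + (0 - (m : ℤ)) + m = i by omega)] at key
  have key' := congrArg (fun y => (Int.negOnePow ((m : ℤ) * n) : ℤ) •
    B.cast rfl (show t n + (i + (0 - (m : ℤ))) = n + i + (v - m) by have := ht n; omega) y) key
  simpa only [map_zsmul, smul_smul, ← Units.val_mul, Int.units_mul_self, Units.val_one, one_smul,
    GMap.entry, LinearMap.comp_apply, Bigraded.cast_cast, Bigraded.cast_rfl] using key'

/-- The family of graded maps whose totalization is a given family of filtered maps. -/
def untotW (t : ℤ → ℤ) (ht : ∀ n, n + v = t n) (T : ∀ n, TotM A n →ₗ[R] TotM B (t n)) :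
    WMap A B 0 v := fun m i j =>
  (Int.negOnePow ((m : ℤ) * (j - i)) : ℤ) •
    (B.cast (i := i + (0 - (m : ℤ))) (j := t (j - i) + (i + (0 - (m : ℤ)))) rfl
      (by rw [← ht]; ring)).comp
      ((LinearMap.proj (φ := fun i' => B.M i' (t (j - i) + i')) (i + (0 - (m : ℤ)))).comp ((totCarrier B (t (j - i))).subtype.comp
        ((T (j - i)).comp ((totSingle A (j - i) i).comp (A.cast rfl (by ring))))))

theorem entry_untotW (t : ℤ → ℤ) (ht : ∀ n, n + v = t n)
    (T : ∀ n, TotM A n →ₗ[R] TotM B (t n)) (m : ℕ) {n k l : ℤ} (hl : l + (0 - (m : ℤ)) = k)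
    (hj : n + l + (v - m) = t n + k) (x : A.M l (n + l)) :
    GMap.entry (untotW t ht T m) hl hj x =
      (Int.negOnePow ((m : ℤ) * n) : ℤ) • (T n (totSingle A n l x)).1 k := by
  subst hl
  have key : ∀ (n₀ : ℤ) (h₀ : n₀ = n),
      B.cast rfl (by rw [h₀]) ((T n₀ (totSingle A n₀ l (A.cast rfl (by rw [h₀]) x))).1
        (l + (0 - (m : ℤ)))) = (T n (totSingle A n l x)).1 (l + (0 - (m : ℤ))) := by
    rintro n₀ rfl
    rfl
  rw [← key (n + l - l) (by ring)]
  simp [GMap.entry, untotW]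

theorem totW_untotW (t : ℤ → ℤ) (ht : ∀ n, n + v = t n)
    (T : ∀ n, TotM A n →ₗ[R] TotM B (t n)) (hT : ∀ n, PreservesFilt (T n)) (n : ℤ) :
    totW (untotW t ht T) n (t n) (ht n) = T n := by
  refine (totW_preservesFilt _ _).ext (hT n) fun k m x => ?_
  rw [totW_single _ _ m rfl, entry_untotW, smul_smul, ← Units.val_mul, Int.units_mul_self,
    Units.val_one, one_smul]

theorem totW_zero {n n' : ℤ} (h : n + v = n') : totW (0 : WMap A B 0 v) n n' h = 0 := by
  refine (totW_preservesFilt _ _).ext (fun p a _ => (totFilt B p n').zero_mem) fun k m x => ?_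
  rw [totW_single _ _ m rfl]
  simp [GMap.entry]

theorem totW_idW (n : ℤ) : totW (idW A) n n (add_zero n) = LinearMap.id := by
  refine (totW_preservesFilt _ _).ext (fun p a ha => ha) fun k m x => ?_
  rw [totW_single _ _ m rfl]
  rcases eq_or_ne m 0 with rfl | hm
  · have key : ∀ (l : ℤ) (hl : l = k) (h₁ : l + (0 - ((0 : ℕ) : ℤ)) = k)
        (h₂ : n + l + (0 - ((0 : ℕ) : ℤ)) = n + k) (y : A.M l (n + l)),
        GMap.entry (idW A 0) h₁ h₂ y = (totSingle A n l y).1 k := by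
      rintro l rfl h₁ h₂ y
      simp [GMap.entry, idW, strictW, grecast, idG]
    simpa using key _ (by simp) (by omega) (by omega) x
  · rw [LinearMap.id_apply, totSingle_of_ne A n (by omega)]
    simp [GMap.entry, idW, strictW, hm]

theorem isTwDiff_iff {d : WMap A A 0 1} :
    IsTwDiff A d ↔ prodW d d (one_add_one_eq_two : (1 : ℤ) + 1 = 2) = 0 := by
  rw [funext_iff]
  refine forall_congr' fun m => ?_
  simp only [prodW, mul_one, Int.negOnePow_def, zpow_natCast, Units.val_pow_eq_pow_val,
    Units.val_neg, Units.val_one]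
  rfl

theorem isTwMor_iff {dA : WMap A A 0 1} {dB : WMap B B 0 1} {f : WMap A B 0 0} :
    IsTwMor dA dB f ↔ prodW dB f (zero_add (1 : ℤ)) = prodW f dA (add_zero (1 : ℤ)) := by
  rw [funext_iff]
  refine forall_congr' fun m => ?_
  simp only [prodW, mul_one, mul_zero, Int.negOnePow_def, zpow_natCast, zpow_zero, one_smul,
    Units.val_pow_eq_pow_val, Units.val_neg, Units.val_one]

theorem compFam_eq_prodW (g : WMap B C 0 0) (f : WMap A B 0 0) :
    compFam g f = prodW g f (add_zero (0 : ℤ)) := by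
  funext m
  simp only [compFam, prodW, mul_zero, Int.negOnePow_zero, Units.val_one, one_smul]

theorem isTwDiff_iff_totDW {d : WMap A A 0 1} :
    IsTwDiff A d ↔ ∀ n, (totDW d (n + 1)).comp (totDW d n) = 0 := by
  have hcomp (n : ℤ) : (totDW d (n + 1)).comp (totDW d n) =
      totW (prodW d d one_add_one_eq_two) n (n + 1 + 1) (by ring) :=
    totW_comp d d one_add_one_eq_two rfl rfl
  simp only [isTwDiff_iff, hcomp]
  refine ⟨fun h n => by rw [h, totW_zero], fun h => ?_⟩
  exact totW_injective (fun n => n + 1 + 1) (fun n => by ring) fun n => by rw [h, totW_zero]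

theorem isTwMor_iff_totMorW {dA : WMap A A 0 1} {dB : WMap B B 0 1} {f : WMap A B 0 0} :
    IsTwMor dA dB f ↔
      ∀ n, (totDW dB n).comp (totMorW f n) = (totMorW f (n + 1)).comp (totDW dA n) := by
  have hleft (n : ℤ) : (totDW dB n).comp (totMorW f n) =
      totW (prodW dB f (zero_add (1 : ℤ))) n (n + 1) rfl :=
    totW_comp dB f (zero_add 1) (add_zero n) rfl
  have hright (n : ℤ) : (totMorW f (n + 1)).comp (totDW dA n) =
      totW (prodW f dA (add_zero (1 : ℤ))) n (n + 1) rfl :=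
    totW_comp f dA (add_zero 1) rfl (add_zero (n + 1))
  simp only [isTwMor_iff, hleft, hright]
  exact ⟨fun h n => by rw [h], totW_injective (fun n => n + 1) fun _ => rfl⟩

end Totalization

/-- Totalization defines a functor from twisted complexes to filtered
cochain complexes: `d ∘ d = 0`, `d` and `Tot(f)` preserve the column filtration, `Tot(f)` is
a chain map, `Tot` preserves identities and composition.  Moreover `Tot` is an isomorphism
of categories onto the full subcategory of split filtered complexes: it is bijective on
morphisms (fully faithful onto filtration-preserving chain maps), and bijective on objects
onto split filtered complexes (a filtered-complex structure on a split filtered module comes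
from a unique twisted complex structure). -/
theorem tot_functor_isomorphism {R : Type} [CommRing R] (A B C : TwComplex R)
    (f : TwMorphism A B) (g : TwMorphism B C) :
    -- `(Tot(A), d)` is a complex
    (∀ n : ℤ, (totDW A.d (n + 1)).comp (totDW A.d n) = 0) ∧
    -- the differential preserves the column filtration
    (∀ p n : ℤ, ∀ a ∈ totFilt A.toBigraded p n, totDW A.d n a ∈ totFilt A.toBigraded p (n + 1)) ∧
    -- `Tot(f)` is a chain map
    (∀ n : ℤ, (totDW B.d n).comp (totMorW f.f n) = (totMorW f.f (n + 1)).comp (totDW A.d n)) ∧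
    -- `Tot(f)` preserves filtrations
    (∀ p n : ℤ, ∀ a ∈ totFilt A.toBigraded p n, totMorW f.f n a ∈ totFilt B.toBigraded p n) ∧
    -- `Tot` preserves identities and composition
    (∀ n : ℤ, totMorW (idW A.toBigraded) n = LinearMap.id) ∧
    (∀ n : ℤ, totMorW (compFam g.f f.f) n = (totMorW g.f n).comp (totMorW f.f n)) ∧
    -- `Tot` is injective on morphisms of twisted complexes
    (∀ φ ψ : TwMorphism A B, (∀ n : ℤ, totMorW φ.f n = totMorW ψ.f n) → φ = ψ) ∧
    -- every filtration-preserving chain map is the totalization of a morphism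
    (∀ T : ∀ n : ℤ, TotM A.toBigraded n →ₗ[R] TotM B.toBigraded n,
        (∀ n : ℤ, (totDW B.d n).comp (T n) = (T (n + 1)).comp (totDW A.d n)) →
        (∀ p n : ℤ, ∀ a ∈ totFilt A.toBigraded p n, T n a ∈ totFilt B.toBigraded p n) →
        ∃ φ : TwMorphism A B, ∀ n : ℤ, totMorW φ.f n = T n) ∧
    -- bijectivity on objects: a filtered-complex structure on a split filtered module is the
    -- totalization of a unique twisted complex structure
    (∀ (A₀ : Bigraded R) (D : ∀ n : ℤ, TotM A₀ n →ₗ[R] TotM A₀ (n + 1)),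
        (∀ n : ℤ, (D (n + 1)).comp (D n) = 0) →
        (∀ p n : ℤ, ∀ a ∈ totFilt A₀ p n, D n a ∈ totFilt A₀ p (n + 1)) →
        ∃! d : WMap A₀ A₀ 0 1, IsTwDiff A₀ d ∧ ∀ n : ℤ, totDW d n = D n) := by
  refine ⟨isTwDiff_iff_totDW.mp A.isTw, fun p n => totW_preservesFilt A.d rfl p,
    isTwMor_iff_totMorW.mp f.isMor, fun p n => totW_preservesFilt f.f (add_zero n) p,
    totW_idW, fun n => ?_, fun φ ψ h => ?_, fun T hT hF => ?_, fun A₀ D hD hF => ?_⟩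
  · rw [compFam_eq_prodW]
    exact (totW_comp g.f f.f (add_zero 0) (add_zero n) (add_zero n)).symm
  · obtain ⟨φf, hφ⟩ := φ
    obtain ⟨ψf, hψ⟩ := ψ
    obtain rfl : φf = ψf := totW_injective (fun n => n) add_zero h
    rfl
  · have hφ : ∀ n, totMorW (untotW (fun n => n) add_zero T) n = T n :=
      totW_untotW _ _ T fun n p => hF p n
    exact ⟨⟨untotW (fun n => n) add_zero T,
      isTwMor_iff_totMorW.mpr fun n => by rw [hφ, hφ, hT]⟩, hφ⟩
  · have hd : ∀ n, totDW (untotW (fun n => n + 1) (fun _ => rfl) D) n = D n :=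
      totW_untotW _ _ D fun n p => hF p n
    refine ⟨untotW (fun n => n + 1) (fun _ => rfl) D,
      ⟨isTwDiff_iff_totDW.mpr fun n => by rw [hd, hd, hD], hd⟩, fun d' h' => ?_⟩
    exact totW_injective (fun n => n + 1) (fun _ => rfl) fun n => (h'.2 n).trans (hd n).symm
end
end

section
/- Let (A, d^A) and (B, d^B) be twisted complexes over R. In wbimod, with d^A := (d^A_i) ∈ wbimod(A,A)_0^1 and d^B := (d^B_i) ∈ wbimod(B,B)_0^1, the following hold: (i) c(d^A, d^A) = 0; (ii) δ∘δ = 0 on wbimod(A,B), so (wbimod(A,B), δ) is a bigraded module with a square-zero differential of bidegree (0,1); (iii) the Leibniz rule δ(c(f,g)) = c(δ(f), g) + (−1)^v c(f, δ(g)) holds for f of bidegree (u,v); (iv) an element f ∈ wbimod(A,B)_0^0 is a morphism of twisted complexes if and only if δ(f) = 0, and for morphisms f, g of twisted complexes, c(f,g) coincides with their composite in the category of twisted complexes. -/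
open Finset

noncomputable section

variable {R : Type} [CommRing R]

/-! ## The enriched hom `wbimod` : composition and differential -/

/-- Composition in `wbimod` : `c(f,g)_m := ∑_{i+j=m} (-1)^{i|g|} f_i g_j`, where `|g| = v' - u'`
is the total degree of `g`. -/
def wcomp {A B C : Bigraded R} {u v u' v' : ℤ} (f : WMap B C u v) (g : WMap A B u' v') :
    WMap A C (u + u') (v + v') :=
  fun m => ∑ ij ∈ (antidiagonal m).attach,
    (Int.negOnePow ((ij.1.1 : ℤ) * (v' - u')) : ℤ) •
      grecast ((u + u') - (m : ℤ)) ((v + v') - (m : ℤ))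
        (by have := mem_antidiagonal.mp ij.2; omega)
        (by have := mem_antidiagonal.mp ij.2; omega)
        (gcomp (f ij.1.1) (g ij.1.2))

/-- Change the recorded bidegree of a `wbimod` element. -/
def wrecast {A B : Bigraded R} {u v : ℤ} (u' v' : ℤ) (hu : u = u') (hv : v = v')
    (f : WMap A B u v) : WMap A B u' v' :=
  fun m => grecast (u' - (m : ℤ)) (v' - (m : ℤ)) (by rw [hu]) (by rw [hv]) (f m)

/-- The vertical differential on `wbimod(A,B)` induced by twisted-complex structures:
`δ(f) := c(d^B, f) - (-1)^{⟨f, d^A⟩} c(f, d^A)`. -/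
def wdelta {A B : Bigraded R} (dA : WMap A A 0 1) (dB : WMap B B 0 1) {u v : ℤ}
    (f : WMap A B u v) : WMap A B u (v + 1) :=
  wrecast u (v + 1) (by ring) (by ring) (wcomp dB f)
  - (Int.negOnePow (u * 0 + v * 1) : ℤ) • wrecast u (v + 1) (by ring) (by ring) (wcomp f dA)

namespace Bigraded

/-- The total module of a bigraded module. -/
abbrev Tot (A : Bigraded R) : Type := DirectSum (ℤ × ℤ) fun p => A.M p.1 p.2

/-- The inclusion of the summand of bidegree `(i,j)` into the total module. -/
def toTot (A : Bigraded R) (i j : ℤ) : A.M i j →ₗ[R] A.Tot :=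
  DirectSum.lof R (ℤ × ℤ) (fun p => A.M p.1 p.2) (i, j)

lemma toTot_injective (A : Bigraded R) (i j : ℤ) : Function.Injective (A.toTot i j) :=
  DirectSum.of_injective (β := fun p : ℤ × ℤ => A.M p.1 p.2) (i, j)

lemma toTot_cast (A : Bigraded R) {i i' j j' : ℤ} (hi : i = i') (hj : j = j') (x : A.M i j) :
    A.toTot i' j' (A.cast hi hj x) = A.toTot i j x := by
  subst hi hj
  rfl

end Bigraded

/-- The linear map between total modules induced by a graded map. -/
def gTot {A B : Bigraded R} {p q : ℤ} : GMap A B p q →+ (A.Tot →ₗ[R] B.Tot) where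
  toFun f := DirectSum.toModule R (ℤ × ℤ) B.Tot fun x =>
    (B.toTot (x.1 + p) (x.2 + q)).comp (f x.1 x.2)
  map_zero' := by
    refine DirectSum.linearMap_ext R fun x => LinearMap.ext fun a => ?_
    simp
  map_add' f g := by
    refine DirectSum.linearMap_ext R fun x => LinearMap.ext fun a => ?_
    simp

lemma gTot_toTot {A B : Bigraded R} {p q : ℤ} (f : GMap A B p q) (i j : ℤ) (a : A.M i j) :
    gTot f (A.toTot i j a) = B.toTot (i + p) (j + q) (f i j a) :=
  DirectSum.toModule_lof (M := fun x : ℤ × ℤ => A.M x.1 x.2)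
    (φ := fun x : ℤ × ℤ => (B.toTot (x.1 + p) (x.2 + q)).comp (f x.1 x.2)) R (i, j) a

lemma tot_hom_ext {A B : Bigraded R} {F G : A.Tot →ₗ[R] B.Tot}
    (h : ∀ i j a, F (A.toTot i j a) = G (A.toTot i j a)) : F = G :=
  DirectSum.linearMap_ext R fun x => LinearMap.ext fun a => h x.1 x.2 a

lemma gTot_injective {A B : Bigraded R} {p q : ℤ} :
    Function.Injective (gTot : GMap A B p q →+ (A.Tot →ₗ[R] B.Tot)) := by
  intro f g h
  funext i j
  refine LinearMap.ext fun a => B.toTot_injective _ _ ?_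
  rw [← gTot_toTot, h, gTot_toTot]

@[simp]
lemma gTot_grecast {A B : Bigraded R} {p q p' q' : ℤ} (hp : p = p') (hq : q = q')
    (f : GMap A B p q) : gTot (grecast p' q' hp hq f) = gTot f := by
  refine tot_hom_ext fun i j a => ?_
  simp [gTot_toTot, grecast, Bigraded.toTot_cast]

@[simp]
lemma gTot_gcomp {A B C : Bigraded R} {p q p' q' : ℤ} (g : GMap B C p' q') (f : GMap A B p q) :
    gTot (gcomp g f) = (gTot g).comp (gTot f) := by
  refine tot_hom_ext fun i j a => ?_
  simp [gTot_toTot, gcomp, Bigraded.toTot_cast]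

/-- The family of linear maps between total modules induced by an element of `wbimod`. -/
def wTot {A B : Bigraded R} {u v : ℤ} : WMap A B u v →+ (ℕ → A.Tot →ₗ[R] B.Tot) where
  toFun f m := gTot (f m)
  map_zero' := by ext1 m; exact map_zero gTot
  map_add' f g := by ext1 m; exact map_add gTot (f m) (g m)

lemma wTot_apply {A B : Bigraded R} {u v : ℤ} (f : WMap A B u v) (m : ℕ) :
    wTot f m = gTot (f m) := rfl

lemma wTot_injective {A B : Bigraded R} {u v : ℤ} :
    Function.Injective (wTot : WMap A B u v →+ (ℕ → A.Tot →ₗ[R] B.Tot)) :=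
  fun _ _ h => funext fun m => gTot_injective (congrFun h m)

/-- Signed convolution of families of linear maps, with sign `(-1)^{i n}`. -/
def signedConv {M N P : Type} [AddCommGroup M] [AddCommGroup N] [AddCommGroup P]
    [Module R M] [Module R N] [Module R P] (n : ℤ) (F : ℕ → N →ₗ[R] P) (G : ℕ → M →ₗ[R] N) :
    ℕ → M →ₗ[R] P :=
  fun m => ∑ ij ∈ antidiagonal m,
    (Int.negOnePow ((ij.1 : ℤ) * n) : ℤ) • (F ij.1).comp (G ij.2)

section signedConv

variable {M N P Q : Type} [AddCommGroup M] [AddCommGroup N] [AddCommGroup P] [AddCommGroup Q]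
  [Module R M] [Module R N] [Module R P] [Module R Q]

lemma signedConv_sub_left (n : ℤ) (F F' : ℕ → N →ₗ[R] P) (G : ℕ → M →ₗ[R] N) :
    signedConv n (F - F') G = signedConv n F G - signedConv n F' G := by
  ext1 m
  simp [signedConv, LinearMap.sub_comp, smul_sub]

lemma signedConv_sub_right (n : ℤ) (F : ℕ → N →ₗ[R] P) (G G' : ℕ → M →ₗ[R] N) :
    signedConv n F (G - G') = signedConv n F G - signedConv n F G' := by
  ext1 m
  simp [signedConv, LinearMap.comp_sub, smul_sub]

lemma zsmul_comp (k : ℤ) (F : N →ₗ[R] P) (G : M →ₗ[R] N) :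
    (k • F).comp G = k • F.comp G :=
  LinearMap.ext fun _ => rfl

lemma comp_zsmul (k : ℤ) (F : N →ₗ[R] P) (G : M →ₗ[R] N) :
    F.comp (k • G) = k • F.comp G :=
  LinearMap.ext fun x => map_zsmul F k (G x)

lemma sum_linearMap_comp {ι : Type} (s : Finset ι) (F : ι → N →ₗ[R] P) (G : M →ₗ[R] N) :
    (∑ i ∈ s, F i).comp G = ∑ i ∈ s, (F i).comp G :=
  map_sum (G.lcomp R P) F s

lemma linearMap_comp_sum {ι : Type} (s : Finset ι) (F : N →ₗ[R] P) (G : ι → M →ₗ[R] N) :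
    F.comp (∑ i ∈ s, G i) = ∑ i ∈ s, F.comp (G i) :=
  map_sum (LinearMap.llcomp R M N P F) G s

lemma signedConv_zsmul_left (n k : ℤ) (F : ℕ → N →ₗ[R] P) (G : ℕ → M →ₗ[R] N) :
    signedConv n (k • F) G = k • signedConv n F G := by
  ext1 m
  simp only [signedConv, Pi.smul_apply, zsmul_comp, smul_sum, smul_smul, mul_comm]

lemma signedConv_zsmul_right (n k : ℤ) (F : ℕ → N →ₗ[R] P) (G : ℕ → M →ₗ[R] N) :
    signedConv n F (k • G) = k • signedConv n F G := by
  ext1 m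
  simp only [signedConv, Pi.smul_apply, comp_zsmul, smul_sum, smul_smul, mul_comm]

@[simp]
lemma signedConv_zero_left (n : ℤ) (G : ℕ → M →ₗ[R] N) :
    signedConv n (0 : ℕ → N →ₗ[R] P) G = 0 := by
  ext1 m
  simp [signedConv]

@[simp]
lemma signedConv_zero_right (n : ℤ) (F : ℕ → N →ₗ[R] P) :
    signedConv n F (0 : ℕ → M →ₗ[R] N) = 0 := by
  ext1 m
  simp [signedConv]

lemma signedConv_assoc (n k : ℤ) (F : ℕ → P →ₗ[R] Q) (G : ℕ → N →ₗ[R] P) (H : ℕ → M →ₗ[R] N) :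
    signedConv k (signedConv n F G) H = signedConv (n + k) F (signedConv k G H) := by
  ext1 m
  simp only [signedConv, sum_linearMap_comp, linearMap_comp_sum, smul_sum, zsmul_comp,
    comp_zsmul, smul_smul]
  rw [Finset.sum_sigma', Finset.sum_sigma']
  refine Finset.sum_nbij'
    (fun x => ⟨(x.2.1, x.2.2 + x.1.2), (x.2.2, x.1.2)⟩)
    (fun x => ⟨(x.1.1 + x.2.1, x.2.2), (x.1.1, x.2.1)⟩) ?_ ?_ ?_ ?_ ?_
  · rintro ⟨⟨a, b⟩, c, d⟩ h
    obtain ⟨rfl, rfl⟩ : a + b = m ∧ c + d = a := by simpa using h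
    simp [add_assoc]
  · rintro ⟨⟨a, b⟩, c, d⟩ h
    obtain ⟨rfl, rfl⟩ : a + b = m ∧ c + d = b := by simpa using h
    simp [add_assoc]
  · rintro ⟨⟨a, b⟩, c, d⟩ h
    obtain ⟨rfl, rfl⟩ : a + b = m ∧ c + d = a := by simpa using h
    rfl
  · rintro ⟨⟨a, b⟩, c, d⟩ h
    obtain ⟨rfl, rfl⟩ : a + b = m ∧ c + d = b := by simpa using h
    rfl
  · rintro ⟨⟨a, b⟩, c, d⟩ h
    obtain ⟨rfl, rfl⟩ : a + b = m ∧ c + d = a := by simpa using h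
    simp only [← Units.val_mul, ← Int.negOnePow_add, LinearMap.comp_assoc]
    congr 3
    push_cast
    ring

end signedConv

@[simp]
lemma wTot_wcomp {A B C : Bigraded R} {u v u' v' : ℤ} (f : WMap B C u v) (g : WMap A B u' v') :
    wTot (wcomp f g) = signedConv (v' - u') (wTot f) (wTot g) := by
  ext1 m
  simp only [wTot_apply, wcomp, map_sum, map_zsmul, gTot_grecast, gTot_gcomp, signedConv]
  exact sum_attach (antidiagonal m) fun ij : ℕ × ℕ =>
    (Int.negOnePow ((ij.1 : ℤ) * (v' - u')) : ℤ) • (gTot (f ij.1)).comp (gTot (g ij.2))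

@[simp]
lemma wTot_wrecast {A B : Bigraded R} {u v u' v' : ℤ} (hu : u = u') (hv : v = v')
    (f : WMap A B u v) : wTot (wrecast u' v' hu hv f) = wTot f :=
  funext fun m => gTot_grecast _ _ (f m)

lemma wTot_wdelta {A B : Bigraded R} (dA : WMap A A 0 1) (dB : WMap B B 0 1) {u v : ℤ}
    (f : WMap A B u v) :
    wTot (wdelta dA dB f) = signedConv (v - u) (wTot dB) (wTot f)
      - (Int.negOnePow v : ℤ) • signedConv 1 (wTot f) (wTot dA) := by
  simp [wdelta]

lemma wcomp_self_eq_zero {A : Bigraded R} {d : WMap A A 0 1} (h : IsTwDiff A d) :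
    wcomp d d = 0 := by
  refine funext fun m => Eq.trans ?_ (h m)
  refine sum_congr rfl fun ij _ => ?_
  congr 1
  simp [Int.coe_negOnePow_natCast]

lemma signedConv_wTot_self {A : Bigraded R} {d : WMap A A 0 1} (h : IsTwDiff A d) :
    signedConv 1 (wTot d) (wTot d) = 0 :=
  (wTot_wcomp d d).symm.trans (by rw [wcomp_self_eq_zero h, map_zero])

lemma isTwMor_iff_wdelta_eq_zero {A B : Bigraded R} (dA : WMap A A 0 1) (dB : WMap B B 0 1)
    (f : WMap A B 0 0) : IsTwMor dA dB f ↔ wdelta dA dB f = 0 := by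
  rw [← wTot_injective.eq_iff, wTot_wdelta, map_zero, funext_iff]
  refine forall_congr' fun m => ?_
  rw [← gTot_injective.eq_iff]
  simp only [map_sum, map_zsmul, gTot_grecast, gTot_gcomp]
  rw [sum_attach (antidiagonal m) fun ij : ℕ × ℕ => (gTot (dB ij.1)).comp (gTot (f ij.2)),
    sum_attach (antidiagonal m) fun ij : ℕ × ℕ =>
      (-1 : ℤ) ^ ij.1 • (gTot (f ij.1)).comp (gTot (dA ij.2))]
  simp [sub_eq_zero, Int.coe_negOnePow_natCast, signedConv, wTot_apply]

lemma wcomp_eq_compFam {A B C : Bigraded R} (f : WMap B C 0 0) (g : WMap A B 0 0) :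
    wcomp f g = compFam f g := by
  refine funext fun m => sum_congr rfl fun ij _ => ?_
  simp

lemma wdelta_wdelta {A B : Bigraded R} {dA : WMap A A 0 1} {dB : WMap B B 0 1}
    (hA : IsTwDiff A dA) (hB : IsTwDiff B dB) {u v : ℤ} (f : WMap A B u v) :
    wdelta dA dB (wdelta dA dB f) = 0 := by
  have hA' : signedConv 1 (wTot dA) (wTot dA) = 0 := signedConv_wTot_self hA
  have hB' : signedConv 1 (wTot dB) (wTot dB) = 0 := signedConv_wTot_self hB
  apply wTot_injective
  have e₁ : v + 1 - u = 1 + (v - u) := by ring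
  have e₂ : v - u + 1 = 1 + (v - u) := by ring
  rw [wTot_wdelta, wTot_wdelta, e₁]
  simp only [signedConv_sub_left, signedConv_sub_right, signedConv_zsmul_left,
    signedConv_zsmul_right, signedConv_assoc 1 1, hA', signedConv_zero_right,
    signedConv_assoc (v - u) 1, e₂, ← signedConv_assoc 1 (v - u), hB', signedConv_zero_left,
    Int.negOnePow_succ, map_zero]
  simp

lemma wdelta_wcomp {A B C : Bigraded R} (dA : WMap A A 0 1) (dB : WMap B B 0 1)
    (dC : WMap C C 0 1) {u v u' v' : ℤ} (f : WMap B C u v) (g : WMap A B u' v') :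
    wdelta dA dC (wcomp f g) =
      wrecast (u + u') (v + v' + 1) (by ring) (by ring) (wcomp (wdelta dB dC f) g)
      + (Int.negOnePow v : ℤ) •
        wrecast (u + u') (v + v' + 1) (by ring) (by ring) (wcomp f (wdelta dA dB g)) := by
  apply wTot_injective
  have e₁ : v + v' - (u + u') = v - u + (v' - u') := by ring
  have e₂ : v' + 1 - u' = 1 + (v' - u') := by ring
  rw [map_add, map_zsmul, wTot_wrecast, wTot_wrecast, wTot_wcomp, wTot_wcomp]
  simp only [wTot_wdelta, wTot_wcomp]
  rw [e₁, e₂]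
  simp only [signedConv_sub_left, signedConv_sub_right, signedConv_zsmul_left,
    signedConv_zsmul_right, signedConv_assoc, add_comm (v' - u') 1, smul_sub, smul_smul,
    Int.negOnePow_add, Units.val_mul]
  abel

/-- **Statement 11.** For twisted complexes `(A,d^A)`, `(B,d^B)`, `(C,d^C)`:
(i) `c(d^A, d^A) = 0`; (ii) `δ ∘ δ = 0` on `wbimod(A,B)`; (iii) the Leibniz rule
`δ(c(f,g)) = c(δ(f),g) + (-1)^v c(f, δ(g))` for `f` of bidegree `(u,v)`;
(iv) `f ∈ wbimod(A,B)_0^0` is a morphism of twisted complexes iff `δ(f) = 0`, and for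
elements of bidegree `(0,0)` the composition `c` coincides with the composition of
morphisms of twisted complexes. -/
theorem wbimod_differential_properties {R : Type} [CommRing R] (A B C : TwComplex R) :
    (wcomp A.d A.d = 0) ∧
    (∀ (u v : ℤ) (f : WMap A.toBigraded B.toBigraded u v),
        wdelta A.d B.d (wdelta A.d B.d f) = 0) ∧
    (∀ (u v u' v' : ℤ) (f : WMap B.toBigraded C.toBigraded u v)
        (g : WMap A.toBigraded B.toBigraded u' v'),
        wdelta A.d C.d (wcomp f g) =
          wrecast (u + u') (v + v' + 1) (by ring) (by ring) (wcomp (wdelta B.d C.d f) g)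
          + (Int.negOnePow v : ℤ) •
            wrecast (u + u') (v + v' + 1) (by ring) (by ring)
              (wcomp f (wdelta A.d B.d g))) ∧
    (∀ f : WMap A.toBigraded B.toBigraded 0 0, IsTwMor A.d B.d f ↔ wdelta A.d B.d f = 0) ∧
    (∀ (f : WMap B.toBigraded C.toBigraded 0 0) (g : WMap A.toBigraded B.toBigraded 0 0),
        wcomp f g = compFam f g) :=
  ⟨wcomp_self_eq_zero A.isTw, fun _ _ f => wdelta_wdelta A.isTw B.isTw f,
    fun _ _ _ _ f g => wdelta_wcomp A.d B.d C.d f g,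
    fun f => isTwMor_iff_wdelta_eq_zero A.d B.d f, fun f g => wcomp_eq_compFam f g⟩
end
end
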